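/- Let d ≥ 1, γ > 0, let f : ℝ → ℝ be twice continuously differentiable, let m : ℝ → ℝ be continuously differentiable with m ≥ 0, and let φ, μ : ℝ × ℝ^d → ℝ be smooth functions that are ℤ^d-periodic in the spatial variable. Suppose the Cahn–Hilliard system ∂_t φ = div( m(φ) ∇μ ) and μ = −γ Δφ + f′(φ) holds on ℝ × ℝ^d. Then for every t, the energy E₀(φ(t)) = ∫_Ω ( (γ/2)|∇φ(t,x)|² + f(φ(t,x)) ) dx over the unit cube Ω = [0,1]^d satisfies d/dt E₀(φ(t)) = − ∫_Ω m(φ(t,x)) |∇μ(t,x)|² dx ≤ 0. -/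

import Mathlib

open MeasureTheory

/-- The `i`-th partial derivative of a function `g : ℝ^d → ℝ`. -/
noncomputable def pderiv {d : ℕ} (g : (Fin d → ℝ) → ℝ) (i : Fin d) (x : Fin d → ℝ) : ℝ :=
  fderiv ℝ g x (Pi.single i 1)

/-- `ℤ^d`-periodicity of a function on `ℝ^d`. -/
def ZdPeriodic {d : ℕ} {E : Type*} (g : (Fin d → ℝ) → E) : Prop :=
  ∀ (x : Fin d → ℝ) (k : Fin d → ℤ), g (x + fun i => (k i : ℝ)) = g x

/-- Differentiation under the integral sign over a compact set. -/
theorem hasDerivAt_setIntegral_of_contDiff {E : Type*} [NormedAddCommGroup E] [NormedSpace ℝ E]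
    [MeasurableSpace E] [BorelSpace E] {ν : Measure E} [IsFiniteMeasureOnCompacts ν] {K : Set E}
    (hK : IsCompact K) {F : ℝ × E → ℝ} (hF : ContDiff ℝ 1 F) (t : ℝ) :
    HasDerivAt (fun s => ∫ x in K, F (s, x) ∂ν) (∫ x in K, fderiv ℝ F (t, x) (1, 0) ∂ν) t := by
  have hF' : Continuous fun p => fderiv ℝ F p (1, 0) :=
    (hF.continuous_fderiv one_ne_zero).clm_apply continuous_const
  have hslice (s : ℝ) : Continuous fun x => F (s, x) := by
    have := hF.continuous
    fun_prop
  obtain ⟨C, hC⟩ := ((isCompact_closedBall t 1).prod hK).exists_bound_of_continuousOn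
    hF'.continuousOn
  refine (hasDerivAt_integral_of_dominated_loc_of_deriv_le (bound := fun _ => C)
    (F' := fun s x => fderiv ℝ F (s, x) (1, 0))
    (Metric.closedBall_mem_nhds t one_pos)
    (.of_forall fun s => ((hslice s).continuousOn.integrableOn_compact hK).aestronglyMeasurable)
    ((hslice t).continuousOn.integrableOn_compact hK)
    (ContinuousOn.integrableOn_compact hK
      (by fun_prop : Continuous fun x => fderiv ℝ F (t, x) (1, 0)).continuousOn).aestronglyMeasurable
    ?_ (continuousOn_const.integrableOn_compact hK) ?_).2
  · filter_upwards [ae_restrict_mem hK.measurableSet] with x hx s hs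
    exact hC (s, x) ⟨hs, hx⟩
  · refine .of_forall fun x s _ => ?_
    exact ((hF.differentiable one_ne_zero) (s, x)).hasFDerivAt.comp_hasDerivAt s
      ((hasDerivAt_id s).prodMk (hasDerivAt_const s x))

theorem ContDiff.continuous_pderiv {d : ℕ} {g : (Fin d → ℝ) → ℝ} (hg : ContDiff ℝ 1 g)
    (i : Fin d) : Continuous (pderiv g i) :=
  (hg.continuous_fderiv one_ne_zero).clm_apply continuous_const

theorem ZdPeriodic.pderiv {d : ℕ} {g : (Fin d → ℝ) → ℝ} (hg : ZdPeriodic g) (i : Fin d) :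
    ZdPeriodic (pderiv g i) := by
  intro x k
  have h : (fun y => g (y + fun i => (k i : ℝ))) = g := funext fun y => hg y k
  unfold _root_.pderiv
  rw [← fderiv_comp_add_right, h]

theorem ZdPeriodic.mul {d : ℕ} {u v : (Fin d → ℝ) → ℝ} (hu : ZdPeriodic u) (hv : ZdPeriodic v) :
    ZdPeriodic fun x => u x * v x := fun x k => congrArg₂ (· * ·) (hu x k) (hv x k)

/-- The integral of a partial derivative of a periodic function over the unit cube vanishes. -/
theorem ZdPeriodic.integral_pderiv_eq_zero {d : ℕ} {g : (Fin d → ℝ) → ℝ} (hper : ZdPeriodic g)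
    (hg : ContDiff ℝ 1 g) (i : Fin d) :
    ∫ x in Set.Icc (0 : Fin d → ℝ) 1, _root_.pderiv g i x = 0 := by
  cases d with
  | zero => exact i.elim0
  | succ n =>
    have hsum (x : Fin (n + 1) → ℝ) :
        ∑ j, (if j = i then fderiv ℝ g x else 0) (Pi.single j 1) = _root_.pderiv g i x := by
      rw [Finset.sum_eq_single i (fun j _ hj => by simp [hj]) (by simp)]
      simp [_root_.pderiv]
    have hdiv := integral_divergence_of_hasFDerivAt_off_countable' (0 : Fin (n + 1) → ℝ) 1
      zero_le_one (fun j => if j = i then g else 0)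
      (fun j x => if j = i then fderiv ℝ g x else 0) ∅ Set.countable_empty
      (fun j => by
        split_ifs
        · exact hg.continuous.continuousOn
        · exact continuousOn_const)
      (fun x _ j => by
        split_ifs
        · exact (hg.differentiable one_ne_zero x).hasFDerivAt
        · exact hasFDerivAt_const 0 x)
      (by
        simp_rw [hsum]
        exact (hg.continuous_pderiv i).continuousOn.integrableOn_compact isCompact_Icc)
    simp_rw [hsum] at hdiv
    rw [hdiv]
    refine Finset.sum_eq_zero fun j _ => sub_eq_zero.2 ?_
    congr 1 with x
    split_ifs
    · refine Eq.trans (congrArg g ?_) (hper (Fin.insertNth j 0 x) (Pi.single j 1))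
      ext l
      refine Fin.succAboveCases j ?_ (fun l => ?_) l <;> simp
    · rfl

/-- Integration by parts for periodic functions on the unit cube. -/
theorem ZdPeriodic.integral_mul_pderiv {d : ℕ} {u v : (Fin d → ℝ) → ℝ} (hu : ZdPeriodic u)
    (hv : ZdPeriodic v) (hu1 : ContDiff ℝ 1 u) (hv1 : ContDiff ℝ 1 v) (i : Fin d) :
    ∫ x in Set.Icc (0 : Fin d → ℝ) 1, u x * _root_.pderiv v i x =
      -∫ x in Set.Icc (0 : Fin d → ℝ) 1, _root_.pderiv u i x * v x := by
  have h := (hu.mul hv).integral_pderiv_eq_zero (hu1.mul hv1) i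
  have hprod (x : Fin d → ℝ) : _root_.pderiv (fun x => u x * v x) i x =
      u x * _root_.pderiv v i x + _root_.pderiv u i x * v x := by
    have hux := hu1.differentiable one_ne_zero x
    have hvx := hv1.differentiable one_ne_zero x
    simp only [_root_.pderiv]
    rw [fderiv_fun_mul hux hvx]
    simp [mul_comm]
  simp_rw [hprod] at h
  rw [integral_add] at h
  · linarith
  · exact (hu1.continuous.mul (hv1.continuous_pderiv i)).continuousOn.integrableOn_compact
      isCompact_Icc
  · exact ((hu1.continuous_pderiv i).mul hv1.continuous).continuousOn.integrableOn_compact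
      isCompact_Icc

theorem pderiv_slice {d : ℕ} {F : ℝ × (Fin d → ℝ) → ℝ} (hF : Differentiable ℝ F) (t : ℝ)
    (i : Fin d) (x : Fin d → ℝ) :
    pderiv (fun z => F (t, z)) i x = fderiv ℝ F (t, x) (0, Pi.single i 1) := by
  have h := (hF (t, x)).hasFDerivAt.comp x (hasFDerivAt_prodMk_right (𝕜 := ℝ) t x)
  simp only [pderiv]
  rw [show (fun z => F (t, z)) = F ∘ fun z => (t, z) from rfl, h.fderiv]
  simp

theorem deriv_slice {E : Type*} [NormedAddCommGroup E] [NormedSpace ℝ E] {F : ℝ × E → ℝ}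
    (hF : Differentiable ℝ F) (t : ℝ) (x : E) :
    deriv (fun s => F (s, x)) t = fderiv ℝ F (t, x) (1, 0) :=
  ((hF (t, x)).hasFDerivAt.comp_hasDerivAt t
    ((hasDerivAt_id t).prodMk (hasDerivAt_const t x))).deriv

theorem fderiv_fderiv_apply_comm {E : Type*} [NormedAddCommGroup E] [NormedSpace ℝ E] {F : E → ℝ}
    (hF : ContDiff ℝ 2 F) (p v w : E) :
    fderiv ℝ (fun q => fderiv ℝ F q v) p w = fderiv ℝ (fun q => fderiv ℝ F q w) p v := by
  have hd : DifferentiableAt ℝ (fderiv ℝ F) p :=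
    (hF.fderiv_right (m := 1) (by norm_num)).differentiable one_ne_zero p
  have hs : IsSymmSndFDerivAt ℝ F p := hF.contDiffAt.isSymmSndFDerivAt (by simp)
  rw [fderiv_clm_apply hd (differentiableAt_const v), fderiv_clm_apply hd (differentiableAt_const w)]
  simpa using hs.eq w v

/-- Energy dissipation for the Cahn–Hilliard system
`∂_t φ = div(m(φ)∇μ)`, `μ = −γΔφ + f′(φ)` with `ℤ^d`-periodic data:
`d/dt E₀(φ(t)) = −∫_Ω m(φ)|∇μ|² dx ≤ 0` over the unit cube `Ω = [0,1]^d`. -/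
theorem CH_energy_dissipation (d : ℕ) (hd : 1 ≤ d) (γ : ℝ) (hγ : 0 < γ)
    (f : ℝ → ℝ) (hf : ContDiff ℝ 2 f)
    (m : ℝ → ℝ) (hm : ContDiff ℝ 1 m) (hm0 : ∀ s : ℝ, 0 ≤ m s)
    (φ μ : ℝ × (Fin d → ℝ) → ℝ)
    (hφ : ContDiff ℝ (⊤ : ℕ∞) φ) (hμ : ContDiff ℝ (⊤ : ℕ∞) μ)
    (hφper : ∀ t : ℝ, ZdPeriodic fun x => φ (t, x))
    (hμper : ∀ t : ℝ, ZdPeriodic fun x => μ (t, x))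
    (hpde : ∀ (t : ℝ) (x : Fin d → ℝ),
      deriv (fun s => φ (s, x)) t =
        ∑ i, pderiv (fun y => m (φ (t, y)) * pderiv (fun z => μ (t, z)) i y) i x)
    (hchem : ∀ (t : ℝ) (x : Fin d → ℝ),
      μ (t, x) =
        -γ * ∑ i, pderiv (pderiv (fun z => φ (t, z)) i) i x + deriv f (φ (t, x))) :
    ∀ t : ℝ,
      HasDerivAt
        (fun s => ∫ x in Set.Icc (0 : Fin d → ℝ) 1,
          (γ / 2 * ∑ i, (pderiv (fun z => φ (s, z)) i x) ^ 2 + f (φ (s, x))))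
        (-(∫ x in Set.Icc (0 : Fin d → ℝ) 1,
            m (φ (t, x)) * ∑ i, (pderiv (fun z => μ (t, z)) i x) ^ 2)) t ∧
      -(∫ x in Set.Icc (0 : Fin d → ℝ) 1,
          m (φ (t, x)) * ∑ i, (pderiv (fun z => μ (t, z)) i x) ^ 2) ≤ 0 := by
  intro t
  have hnonneg : 0 ≤ ∫ x in Set.Icc (0 : Fin d → ℝ) 1,
      m (φ (t, x)) * ∑ i, (pderiv (fun z => μ (t, z)) i x) ^ 2 :=
    integral_nonneg fun x => mul_nonneg (hm0 _) (Finset.sum_nonneg fun i _ => sq_nonneg _)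
  refine ⟨?_, neg_nonpos.2 hnonneg⟩
  have hφd : Differentiable ℝ φ := hφ.differentiable (by simp)
  have hdir (F : ℝ × (Fin d → ℝ) → ℝ) (hF : ContDiff ℝ (⊤ : ℕ∞) F) (v : ℝ × (Fin d → ℝ)) :
      ContDiff ℝ 1 fun p => fderiv ℝ F p v :=
    (hF.fderiv_right (m := 1) (WithTop.coe_le_coe.2 le_top)).clm_apply contDiff_const
  have hslice (F : ℝ × (Fin d → ℝ) → ℝ) (hF : ContDiff ℝ 1 F) : ContDiff ℝ 1 fun x => F (t, x) :=
    hF.comp (contDiff_const.prodMk contDiff_id)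
  have hpd (F : ℝ × (Fin d → ℝ) → ℝ) (hF : ContDiff ℝ (⊤ : ℕ∞) F) (i : Fin d) :
      ContDiff ℝ 1 (pderiv (fun z => F (t, z)) i) := by
    rw [funext (pderiv_slice (hF.differentiable (by simp)) t i)]
    exact hslice _ (hdir F hF _)
  have hφ1 : ContDiff ℝ 1 φ := hφ.of_le (by exact_mod_cast le_top)
  have hμ1 : ContDiff ℝ 1 μ := hμ.of_le (by exact_mod_cast le_top)
  have hf1 : ContDiff ℝ 1 f := hf.of_le (by norm_num)
  have hf' : Continuous (deriv f) := hf1.continuous_deriv le_rfl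
  set D : (Fin d → ℝ) → ℝ := fun x => fderiv ℝ φ (t, x) (1, 0) with hD
  have hD1 : ContDiff ℝ 1 D := hslice _ (hdir φ hφ _)
  have hDper : ZdPeriodic D := fun x k => by
    simp only [hD, ← deriv_slice hφd]
    congr 1 with s
    exact hφper s x k
  have hflux (i : Fin d) :
      ContDiff ℝ 1 fun y => m (φ (t, y)) * pderiv (fun z => μ (t, z)) i y :=
    (hm.comp (hslice φ hφ1)).mul (hpd μ hμ i)
  have hfluxper (i : Fin d) :
      ZdPeriodic fun y => m (φ (t, y)) * pderiv (fun z => μ (t, z)) i y :=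
    ZdPeriodic.mul (fun x k => congrArg m (hφper t x k)) ((hμper t).pderiv i)
  have hint {g : (Fin d → ℝ) → ℝ} (hg : Continuous g) : IntegrableOn g (Set.Icc 0 1) :=
    hg.continuousOn.integrableOn_compact isCompact_Icc
  have hpdc (i : Fin d) := (hpd φ hφ i).continuous
  have hpdpdc (i : Fin d) := (hpd φ hφ i).continuous_pderiv i
  have hDi (i : Fin d) := hD1.continuous_pderiv i
  have hDc := hD1.continuous
  have hφc := (hslice φ hφ1).continuous
  have hμc := (hslice μ hμ1).continuous
  have hF : ContDiff ℝ 1 fun p : ℝ × (Fin d → ℝ) =>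
      γ / 2 * ∑ i, (fderiv ℝ φ p (0, Pi.single i 1)) ^ 2 + f (φ p) :=
    (contDiff_const.mul (ContDiff.sum fun i _ => (hdir φ hφ _).pow 2)).add (hf1.comp hφ1)
  have hderiv (x : Fin d → ℝ) : fderiv ℝ (fun p : ℝ × (Fin d → ℝ) =>
      γ / 2 * ∑ i, (fderiv ℝ φ p (0, Pi.single i 1)) ^ 2 + f (φ p)) (t, x) (1, 0) =
      γ * ∑ i, pderiv (fun z => φ (t, z)) i x * pderiv D i x + deriv f (φ (t, x)) * D x := by
    have h1 (i : Fin d) := (((hdir φ hφ (0, Pi.single i 1)).differentiable one_ne_zero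
      (t, x)).hasFDerivAt).pow 2
    have h2 := (hf1.differentiable one_ne_zero (φ (t, x))).hasDerivAt.comp_hasFDerivAt (t, x)
      (hφd (t, x)).hasFDerivAt
    have h3 := ((HasFDerivAt.fun_sum fun i (_ : i ∈ Finset.univ) => h1 i).const_mul (γ / 2)).add h2
    have hDx (i : Fin d) : pderiv D i x =
        fderiv ℝ (fun q => fderiv ℝ φ q (0, Pi.single i 1)) (t, x) (1, 0) := by
      rw [fderiv_fderiv_apply_comm (hφ.of_le (WithTop.coe_le_coe.2 le_top))]
      exact pderiv_slice ((hdir φ hφ (1, 0)).differentiable one_ne_zero) t i x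
    refine (congrArg (fun L : ℝ × (Fin d → ℝ) →L[ℝ] ℝ => L (1, 0)) h3.fderiv).trans ?_
    simp only [hDx, pderiv_slice hφd]
    simp [Finset.mul_sum, hD]
    refine Finset.sum_congr rfl fun i _ => by ring
  have key := hasDerivAt_setIntegral_of_contDiff (ν := volume)
    (isCompact_Icc (a := (0 : Fin d → ℝ)) (b := 1)) hF t
  simp_rw [hderiv] at key
  simp_rw [pderiv_slice hφd]
  convert key using 1
  calc -(∫ x in Set.Icc (0 : Fin d → ℝ) 1,
        m (φ (t, x)) * ∑ i, (pderiv (fun z => μ (t, z)) i x) ^ 2)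
      = ∑ i, -∫ x in Set.Icc (0 : Fin d → ℝ) 1, pderiv (fun z => μ (t, z)) i x *
          (m (φ (t, x)) * pderiv (fun z => μ (t, z)) i x) := by
        rw [Finset.sum_neg_distrib, ← integral_finsetSum _ fun i _ =>
          hint (by exact (hpd μ hμ i).continuous.mul (hflux i).continuous)]
        congr 2 with x
        rw [Finset.mul_sum]
        exact Finset.sum_congr rfl fun i _ => by ring
    _ = ∑ i, ∫ x in Set.Icc (0 : Fin d → ℝ) 1, μ (t, x) *
          pderiv (fun y => m (φ (t, y)) * pderiv (fun z => μ (t, z)) i y) i x :=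
        Finset.sum_congr rfl fun i _ =>
          ((hμper t).integral_mul_pderiv (hfluxper i) (hslice μ hμ1) (hflux i) i).symm
    _ = ∫ x in Set.Icc (0 : Fin d → ℝ) 1, μ (t, x) * D x := by
        rw [← integral_finsetSum _ fun i _ =>
          hint (by exact hμc.mul ((hflux i).continuous_pderiv i))]
        congr 1 with x
        rw [← Finset.mul_sum, ← hpde, deriv_slice hφd]
    _ = ∫ x in Set.Icc (0 : Fin d → ℝ) 1,
          (γ * ∑ i, -(pderiv (pderiv (fun z => φ (t, z)) i) i x * D x) +
            deriv f (φ (t, x)) * D x) := by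
        congr 1 with x
        rw [hchem, Finset.sum_neg_distrib, ← Finset.sum_mul]
        ring
    _ = _ := by
        rw [integral_add (hint (by fun_prop)) (hint (by fun_prop)),
          integral_add (hint (by fun_prop)) (hint (by fun_prop)),
          integral_const_mul, integral_const_mul,
          integral_finsetSum _ fun i _ => hint (by fun_prop),
          integral_finsetSum _ fun i _ => hint (by fun_prop)]
        congr 2
        refine Finset.sum_congr rfl fun i _ => ?_
        rw [integral_neg, ((hφper t).pderiv i).integral_mul_pderiv hDper (hpd φ hφ i) hD1 i]
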